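/- Let R = S ×_k T be a non-trivial fiber product, let M_1 be a finitely generated S-module and N_2 a finitely generated T-module, both regarded as R-modules via the surjections R → S and R → T. Then there are isomorphisms of R-modules Tor_1^R(M_1, N_2) ≅ Tor_1^T(k, N_2)^{β_0^S(M_1)} ⊕ (N_2/m_T N_2)^{β_1^S(M_1)} and Tor_1^R(M_1, N_2) ≅ Tor_1^S(M_1, k)^{β_0^T(N_2)} ⊕ (M_1/m_S M_1)^{β_1^T(N_2)}. -/

import Mathlib

open CategoryTheory Opposite IsLocalRing

noncomputable section

/-- Vanishing of `Tor_i^A(M, N)`. -/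
abbrev TorZero (A : Type) [CommRing A] (M N : Type) [AddCommGroup M] [Module A M]
    [AddCommGroup N] [Module A N] (i : ℕ) : Prop :=
  Subsingleton (((Tor (ModuleCat A) i).obj (ModuleCat.of A M)).obj (ModuleCat.of A N))

/-- Vanishing of `Ext^i_A(M, N)`. -/
abbrev ExtZero (A : Type) [CommRing A] (M N : Type) [AddCommGroup M] [Module A M]
    [AddCommGroup N] [Module A N] (i : ℕ) : Prop :=
  Subsingleton (((Ext A (ModuleCat A) i).obj (op (ModuleCat.of A M))).obj (ModuleCat.of A N))

/-- `M` has projective dimension at most `n` over `A`: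
`Ext^i_A(M, -) = 0` for all `i > n`. -/
def PdLE (A : Type) [CommRing A] (M : Type) [AddCommGroup M] [Module A M] (n : ℕ) : Prop :=
  ∀ (N : ModuleCat A) (i : ℕ), n < i →
    Subsingleton (((Ext A (ModuleCat A) i).obj (op (ModuleCat.of A M))).obj N)

/-- `N` has injective dimension at most `n` over `A`:
`Ext^i_A(-, N) = 0` for all `i > n`. -/
def IdLE (A : Type) [CommRing A] (N : Type) [AddCommGroup N] [Module A N] (n : ℕ) : Prop :=
  ∀ (X : ModuleCat A) (i : ℕ), n < i →
    Subsingleton (((Ext A (ModuleCat A) i).obj (op X)).obj (ModuleCat.of A N))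

/-- The depth of a module over a noetherian local ring, as an extended natural number:
`inf { i | Ext^i_A(k, M) ≠ 0 }`. -/
def depthM (A : Type) [CommRing A] [IsLocalRing A] (M : Type) [AddCommGroup M]
    [Module A M] : ℕ∞ :=
  sInf {n : ℕ∞ | ∃ i : ℕ, n = i ∧
    ¬ Subsingleton (((Ext A (ModuleCat A) i).obj
        (op (ModuleCat.of A (A ⧸ maximalIdeal A)))).obj (ModuleCat.of A M))}

/-- The fiber product `S ×ₖ T` as a subring of `S × T`. -/
def fiberProd {S T k : Type} [CommRing S] [CommRing T] [CommRing k]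
    (πS : S →+* k) (πT : T →+* k) : Subring (S × T) :=
  RingHom.eqLocus (πS.comp (RingHom.fst S T)) (πT.comp (RingHom.snd S T))

/-- The projection from the fiber product to `S`. -/
def ρS {S T k : Type} [CommRing S] [CommRing T] [CommRing k]
    (πS : S →+* k) (πT : T →+* k) : ↥(fiberProd πS πT) →+* S :=
  (RingHom.fst S T).comp (fiberProd πS πT).subtype

/-- The projection from the fiber product to `T`. -/
def ρT {S T k : Type} [CommRing S] [CommRing T] [CommRing k]
    (πS : S →+* k) (πT : T →+* k) : ↥(fiberProd πS πT) →+* T :=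
  (RingHom.snd S T).comp (fiberProd πS πT).subtype

/-- The `i`-th Betti number of a module `M` over a noetherian local ring `A`:
the `k`-dimension of `Tor_i^A(M, k) ⊗_A k`; since `Tor_i^A(M, k)` is annihilated
by the maximal ideal, this is `dim_k Tor_i^A(M, k)`. -/
noncomputable def betti (A : Type) [CommRing A] [IsLocalRing A] (M : Type) [AddCommGroup M]
    [Module A M] (i : ℕ) : ℕ :=
  let X : ModuleCat A :=
    ((Tor (ModuleCat A) i).obj (ModuleCat.of A M)).obj (ModuleCat.of A (A ⧸ maximalIdeal A))
  Module.finrank (A ⧸ maximalIdeal A) (X ⧸ (maximalIdeal A • (⊤ : Submodule A X)))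

section Presentations

open TensorProduct

/-- Given `γ : U → V` surjective and `θ : U → X` injective with `ε ∘ γ = δ ∘ θ`, the kernel of
`ε` is `(ker δ ∩ im θ) / θ (ker γ)`. -/
theorem nonempty_ker_equiv_quotient {A U V X Y : Type*} [CommRing A]
    [AddCommGroup U] [Module A U] [AddCommGroup V] [Module A V]
    [AddCommGroup X] [Module A X] [AddCommGroup Y] [Module A Y]
    (θ : U →ₗ[A] X) (γ : U →ₗ[A] V) (δ : X →ₗ[A] Y) (ε : V →ₗ[A] Y)
    (hθ : Function.Injective θ) (hγ : Function.Surjective γ) (h : ε ∘ₗ γ = δ ∘ₗ θ) :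
    Nonempty (LinearMap.ker ε ≃ₗ[A]
      (↥(LinearMap.ker δ ⊓ LinearMap.range θ) ⧸
        ((LinearMap.ker γ).map θ).submoduleOf (LinearMap.ker δ ⊓ LinearMap.range θ))) := by
  have h' : ∀ u, ε (γ u) = δ (θ u) := fun u => LinearMap.congr_fun h u
  let W := LinearMap.ker (δ ∘ₗ θ)
  let f : W →ₗ[A] LinearMap.ker ε := (γ ∘ₗ W.subtype).codRestrict _ (fun w => by
    simp only [LinearMap.mem_ker, LinearMap.comp_apply, Submodule.subtype_apply, h']
    exact w.2)
  have hf : Function.Surjective f := by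
    rintro ⟨v, hv⟩
    obtain ⟨u, rfl⟩ := hγ v
    refine ⟨⟨u, ?_⟩, ?_⟩
    · simpa [W, h'] using hv
    · ext; rfl
  let g : W →ₗ[A] ↥(LinearMap.ker δ ⊓ LinearMap.range θ) :=
    (θ ∘ₗ W.subtype).codRestrict _ (fun w => ⟨LinearMap.mem_ker.1 w.2, by simp⟩)
  have hg : Function.Bijective g := by
    constructor
    · intro a b hab
      exact Subtype.ext (hθ (congrArg Subtype.val hab))
    · rintro ⟨x, hx, u, rfl⟩
      exact ⟨⟨u, by simpa [W] using hx⟩, rfl⟩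
  refine ⟨(LinearMap.quotKerEquivOfSurjective f hf).symm ≪≫ₗ
    Submodule.Quotient.equiv _ _ (LinearEquiv.ofBijective g hg) ?_⟩
  ext ⟨x, hx, u, rfl⟩
  simp only [Submodule.mem_map, Submodule.submoduleOf, Submodule.mem_comap]
  constructor
  · rintro ⟨w, hw, hwx⟩
    refine ⟨w, ?_, congrArg Subtype.val hwx⟩
    exact congrArg Subtype.val (LinearMap.mem_ker.1 hw)
  · rintro ⟨w, hw, hwx⟩
    obtain rfl := hθ hwx
    refine ⟨⟨w, by simpa [W] using hx⟩, ?_, rfl⟩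
    exact Subtype.ext hw

/-- A linear equivalence matching the zeros of two linear maps, possibly over different rings,
restricts to an equivalence of their kernels. -/
def kerEquivOfIff {A B V V' W W' : Type*} [CommRing A] [CommRing B] [Algebra A B]
    [AddCommGroup V] [Module A V] [AddCommGroup W] [Module A W]
    [AddCommGroup V'] [Module A V'] [Module B V'] [IsScalarTower A B V']
    [AddCommGroup W'] [Module B W'] (e : V ≃ₗ[A] V') (f : V →ₗ[A] W) (f' : V' →ₗ[B] W')
    (h : ∀ x, f x = 0 ↔ f' (e x) = 0) : LinearMap.ker f ≃ₗ[A] LinearMap.ker f' where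
  toFun x := ⟨e x, (h x).1 x.2⟩
  invFun y := ⟨e.symm y, (h _).2 (by simp)⟩
  map_add' x y := by ext; simp
  map_smul' a x := by ext; simp
  left_inv x := by ext; simp
  right_inv y := by ext; simp

section Balance

variable {A K F M I P N : Type*} [CommRing A]
  [AddCommGroup K] [Module A K] [AddCommGroup F] [Module A F] [AddCommGroup M] [Module A M]
  [AddCommGroup I] [Module A I] [AddCommGroup P] [Module A P] [AddCommGroup N] [Module A N]

/-- Balancing of `Tor₁`: it can be computed from a flat presentation of either argument. -/
theorem nonempty_ker_lTensor_equiv_ker_lTensor [Module.Flat A F] [Module.Flat A P]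
    {i : K →ₗ[A] F} {g : F →ₗ[A] M} {j : I →ₗ[A] P} {h : P →ₗ[A] N}
    (hi : Function.Injective i) (hig : Function.Exact i g) (hg : Function.Surjective g)
    (hj : Function.Injective j) (hjh : Function.Exact j h) (hh : Function.Surjective h) :
    Nonempty (LinearMap.ker (j.lTensor M) ≃ₗ[A] LinearMap.ker (i.lTensor N)) := by
  obtain ⟨e₁⟩ := nonempty_ker_equiv_quotient (j.lTensor F) (g.rTensor I) (g.rTensor P)
    (j.lTensor M) (Module.Flat.lTensor_preserves_injective_linearMap _ hj)
    (LinearMap.rTensor_surjective _ hg)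
    (by rw [LinearMap.lTensor_comp_rTensor, LinearMap.rTensor_comp_lTensor])
  obtain ⟨e₂⟩ := nonempty_ker_equiv_quotient (i.rTensor P) (h.lTensor K) (h.lTensor F)
    (i.rTensor N) (Module.Flat.rTensor_preserves_injective_linearMap _ hi)
    (LinearMap.lTensor_surjective _ hh)
    (by rw [LinearMap.lTensor_comp_rTensor, LinearMap.rTensor_comp_lTensor])
  have k₁ : LinearMap.ker (g.rTensor P) = LinearMap.range (i.rTensor P) :=
    LinearMap.exact_iff.1 (rTensor_exact P hig hg)
  have k₂ : LinearMap.ker (g.rTensor I) = LinearMap.range (i.rTensor I) :=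
    LinearMap.exact_iff.1 (rTensor_exact I hig hg)
  have k₃ : LinearMap.ker (h.lTensor F) = LinearMap.range (j.lTensor F) :=
    LinearMap.exact_iff.1 (lTensor_exact F hjh hh)
  have k₄ : LinearMap.ker (h.lTensor K) = LinearMap.range (j.lTensor K) :=
    LinearMap.exact_iff.1 (lTensor_exact K hjh hh)
  have q₁ : LinearMap.ker (g.rTensor P) ⊓ LinearMap.range (j.lTensor F) =
      LinearMap.ker (h.lTensor F) ⊓ LinearMap.range (i.rTensor P) := by
    rw [k₁, k₃, inf_comm]
  have q₂ : (LinearMap.ker (g.rTensor I)).map (j.lTensor F) =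
      (LinearMap.ker (h.lTensor K)).map (i.rTensor P) := by
    rw [k₂, k₄, ← LinearMap.range_comp, ← LinearMap.range_comp, LinearMap.lTensor_comp_rTensor,
      LinearMap.rTensor_comp_lTensor]
  rw [q₁, q₂] at e₁
  have e₃ : LinearMap.ker (i.rTensor N) ≃ₗ[A] LinearMap.ker (i.lTensor N) :=
    kerEquivOfIff (TensorProduct.comm A K N) _ _ (fun x => by
      rw [← LinearMap.comm_comp_rTensor_comp_comm_eq]
      simp)
  exact ⟨e₁ ≪≫ₗ e₂.symm ≪≫ₗ e₃⟩

end Balance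

theorem nonempty_homology_equiv_ker_lTensor {A : Type} [CommRing A] {M P₂ P₁ P₀ : Type}
    [AddCommGroup P₂] [Module A P₂] [AddCommGroup P₁] [Module A P₁]
    [AddCommGroup P₀] [Module A P₀] [AddCommGroup M] [Module A M]
    (d₂ : P₂ →ₗ[A] P₁) (d₁ : P₁ →ₗ[A] P₀)
    (h : Function.Exact d₂ d₁) :
    Nonempty (LinearMap.ker ((LinearMap.range d₁).subtype.lTensor M) ≃ₗ[A]
      (LinearMap.ker (d₁.lTensor M) ⧸
        (LinearMap.range (d₂.lTensor M)).submoduleOf (LinearMap.ker (d₁.lTensor M)))) := by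
  obtain ⟨e⟩ := nonempty_ker_equiv_quotient LinearMap.id (d₁.rangeRestrict.lTensor M)
    (d₁.lTensor M) ((LinearMap.range d₁).subtype.lTensor M) Function.injective_id
    (LinearMap.lTensor_surjective _ d₁.surjective_rangeRestrict)
    (by rw [← LinearMap.lTensor_comp]; rfl)
  have hk : LinearMap.ker (d₁.rangeRestrict.lTensor M) = LinearMap.range (d₂.lTensor M) :=
    LinearMap.exact_iff.1 (lTensor_exact M (by
      rw [LinearMap.exact_iff] at h ⊢
      rw [LinearMap.ker_rangeRestrict, h]) d₁.surjective_rangeRestrict)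
  rw [Submodule.map_id, LinearMap.range_id, inf_top_eq, hk] at e
  exact ⟨e⟩

/-- `Tor₁(M, N)` computed from a flat presentation of `N`. -/
theorem nonempty_tor_one_equiv_ker_lTensor {A : Type} [CommRing A] {M N I P : Type}
    [AddCommGroup I] [Module A I] [AddCommGroup P] [Module A P] [Module.Flat A P]
    [AddCommGroup M] [Module A M] [AddCommGroup N] [Module A N]
    {j : I →ₗ[A] P} {h : P →ₗ[A] N}
    (hj : Function.Injective j) (hjh : Function.Exact j h) (hh : Function.Surjective h) :
    Nonempty ((((Tor (ModuleCat A) 1).obj (ModuleCat.of A M)).obj (ModuleCat.of A N)) ≃ₗ[A]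
      LinearMap.ker (j.lTensor M)) := by
  let Q := projectiveResolution (ModuleCat.of A N)
  let d₂ := (Q.complex.d 2 1).hom
  let d₁ := (Q.complex.d 1 0).hom
  let p : Q.complex.X 0 →ₗ[A] N := (Q.π.f 0).hom
  have ex : Function.Exact d₂ d₁ :=
    (ShortComplex.ShortExact.moduleCat_exact_iff_function_exact _).1 (Q.exact_succ 0)
  have ex0 : Function.Exact d₁ p :=
    (ShortComplex.ShortExact.moduleCat_exact_iff_function_exact _).1 Q.exact₀
  have hp : Function.Surjective p :=
    (ModuleCat.epi_iff_surjective (Q.π.f 0)).1 inferInstance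
  have : Module.Projective A (Q.complex.X 0) :=
    (IsProjective.iff_projective (R := A) (Q.complex.X 0)).2 (Q.projective 0)
  obtain ⟨e₁⟩ := nonempty_homology_equiv_ker_lTensor (M := M) d₂ d₁ ex
  let b := Finsupp.linearCombination A (id : M → M)
  have hb : Function.Surjective b := Finsupp.linearCombination_id_surjective A M
  have hrange : Function.Exact (LinearMap.range d₁).subtype p := by
    rw [LinearMap.exact_iff] at ex0 ⊢
    rw [ex0, Submodule.range_subtype]
  have hker : Function.Exact (LinearMap.ker b).subtype b := by
    rw [LinearMap.exact_iff, Submodule.range_subtype]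
  obtain ⟨e₂⟩ := nonempty_ker_lTensor_equiv_ker_lTensor (Submodule.subtype_injective _) hker hb
    (Submodule.subtype_injective _) hrange hp
  obtain ⟨e₃⟩ := nonempty_ker_lTensor_equiv_ker_lTensor (Submodule.subtype_injective _) hker hb
    hj hjh hh
  let i₁ := (Q.isoLeftDerivedObj ((MonoidalCategory.tensoringLeft (ModuleCat A)).obj (ModuleCat.of A M)) 1) ≪≫
    HomologicalComplex.homologyIsoSc' _ 2 1 0 (by simp) (by simp) ≪≫
    ShortComplex.moduleCatHomologyIso _
  have e₄ : (LinearMap.ker (d₁.lTensor M) ⧸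
        (LinearMap.range (d₂.lTensor M)).submoduleOf (LinearMap.ker (d₁.lTensor M))) ≃ₗ[A]
      (((Tor (ModuleCat A) 1).obj (ModuleCat.of A M)).obj (ModuleCat.of A N)) := by
    refine Submodule.quotEquivOfEq _ (LinearMap.range ((d₂.lTensor M).codRestrict _ (fun x => ?_)))
      ?_ ≪≫ₗ i₁.toLinearEquiv.symm
    · rw [LinearMap.mem_ker, ← LinearMap.comp_apply, ← LinearMap.lTensor_comp,
        ex.linearMap_comp_eq_zero, LinearMap.lTensor_zero, LinearMap.zero_apply]
    · rw [LinearMap.range_codRestrict]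
      rfl
  exact ⟨e₄.symm ≪≫ₗ e₁.symm ≪≫ₗ e₂ ≪≫ₗ e₃.symm⟩

/-- `Tor₁(M, N)` computed from a flat presentation of `M`. -/
theorem nonempty_tor_one_equiv_ker_lTensor_of_left {A : Type} [CommRing A] {K F M N : Type}
    [AddCommGroup K] [Module A K] [AddCommGroup F] [Module A F] [Module.Flat A F]
    [AddCommGroup M] [Module A M] [AddCommGroup N] [Module A N]
    {i : K →ₗ[A] F} {g : F →ₗ[A] M}
    (hi : Function.Injective i) (hig : Function.Exact i g) (hg : Function.Surjective g) :
    Nonempty ((((Tor (ModuleCat A) 1).obj (ModuleCat.of A M)).obj (ModuleCat.of A N)) ≃ₗ[A]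
      LinearMap.ker (i.lTensor N)) := by
  have hb : Function.Surjective (Finsupp.linearCombination A (id : N → N)) :=
    Finsupp.linearCombination_id_surjective A N
  have hker := LinearMap.exact_subtype_ker_map (Finsupp.linearCombination A (id : N → N))
  obtain ⟨e₁⟩ := nonempty_tor_one_equiv_ker_lTensor (M := M) (Submodule.subtype_injective _) hker hb
  obtain ⟨e₂⟩ := nonempty_ker_lTensor_equiv_ker_lTensor hi hig hg
    (Submodule.subtype_injective _) hker hb
  exact ⟨e₁ ≪≫ₗ e₂⟩

theorem nonempty_tor_zero_equiv_tensorProduct {A : Type} [CommRing A] (M N : Type)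
    [AddCommGroup M] [Module A M] [AddCommGroup N] [Module A N] :
    Nonempty ((((Tor (ModuleCat A) 0).obj (ModuleCat.of A M)).obj (ModuleCat.of A N)) ≃ₗ[A]
      M ⊗[A] N) := by
  let F := (MonoidalCategory.tensoringLeft (ModuleCat A)).obj (ModuleCat.of A M)
  have : Limits.PreservesFiniteColimits F :=
    inferInstanceAs (Limits.PreservesFiniteColimits
      (MonoidalCategory.tensorLeft (ModuleCat.of A M)))
  exact ⟨(F.leftDerivedZeroIsoSelf.app (ModuleCat.of A N)).toLinearEquiv⟩

section Betti

variable (A : Type) [CommRing A] [IsLocalRing A] (M : Type) [AddCommGroup M] [Module A M]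

/-- The minimal number of generators `dim_k M / m M` of a module over a local ring. -/
def residueRank : ℕ :=
  Module.finrank (A ⧸ maximalIdeal A) (M ⧸ (maximalIdeal A • (⊤ : Submodule A M)))

variable {A M}

theorem residueRank_congr {N : Type} [AddCommGroup N] [Module A N] (e : M ≃ₗ[A] N) :
    residueRank A M = residueRank A N := by
  refine LinearEquiv.finrank_eq (LinearEquiv.extendScalarsOfSurjective (R := A)
    Ideal.Quotient.mk_surjective (Submodule.Quotient.equiv _ _ e ?_))
  rw [Submodule.map_smul'', Submodule.map_top, LinearEquiv.range]

theorem residueRank_quotient :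
    residueRank A (M ⧸ (maximalIdeal A • (⊤ : Submodule A M))) = residueRank A M := by
  refine LinearEquiv.finrank_eq (LinearEquiv.extendScalarsOfSurjective (R := A)
    Ideal.Quotient.mk_surjective (Submodule.quotEquivOfEqBot _ ?_))
  rw [← Submodule.range_mkQ, ← Submodule.map_top, ← Submodule.map_smul'', Submodule.mkQ_map_self]

theorem residueRank_tensorProduct :
    residueRank A ((A ⧸ maximalIdeal A) ⊗[A] M) = residueRank A M :=
  (residueRank_congr (TensorProduct.quotTensorEquivQuotSMul M _)).trans residueRank_quotient

variable (A M) in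
theorem nonempty_quotient_smul_top_equiv_pi [Module.Finite A M] :
    Nonempty ((M ⧸ (maximalIdeal A • (⊤ : Submodule A M))) ≃ₗ[A]
      (Fin (residueRank A M) → A ⧸ maximalIdeal A)) := by
  let : Field (A ⧸ maximalIdeal A) := Ideal.Quotient.field _
  exact ⟨(Module.finBasis (A ⧸ maximalIdeal A)
    (M ⧸ (maximalIdeal A • (⊤ : Submodule A M)))).equivFun.restrictScalars A⟩

variable (A M) in
theorem exists_minimal_presentation [Module.Finite A M] :
    ∃ g : (Fin (residueRank A M) → A) →ₗ[A] M, Function.Surjective g ∧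
      ∀ x ∈ LinearMap.ker g, ∀ i, x i ∈ maximalIdeal A := by
  obtain ⟨e⟩ := nonempty_quotient_smul_top_equiv_pi A M
  choose x hx using fun i => Submodule.mkQ_surjective (maximalIdeal A • (⊤ : Submodule A M))
    (e.symm (Pi.single i 1))
  let g := Fintype.linearCombination A x
  have hg : ∀ s, e (Submodule.mkQ _ (g s)) = fun i => Ideal.Quotient.mk (maximalIdeal A) (s i) := by
    intro s
    simp only [g, Fintype.linearCombination_apply, map_sum, map_smul, hx, LinearEquiv.apply_symm_apply]
    ext i
    simp [Finset.sum_apply, Pi.single_apply, Algebra.smul_def]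
  refine ⟨g, ?_, fun s hs i => ?_⟩
  · rw [← LinearMap.range_eq_top, ← map_mkQ_eq_top, eq_top_iff]
    intro y _
    choose s hs using fun i => Ideal.Quotient.mk_surjective (e y i)
    refine ⟨g s, ⟨s, rfl⟩, e.injective ?_⟩
    rw [hg]
    exact funext hs
  · rw [← Ideal.Quotient.eq_zero_iff_mem]
    have := congrFun (hg s) i
    rw [LinearMap.mem_ker.1 hs] at this
    simpa using this.symm

variable (A M) in
theorem betti_zero : betti A M 0 = residueRank A M := by
  obtain ⟨e⟩ := nonempty_tor_zero_equiv_tensorProduct (A := A) M (A ⧸ maximalIdeal A)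
  exact (residueRank_congr (e ≪≫ₗ TensorProduct.comm _ _ _)).trans residueRank_tensorProduct

theorem betti_one {ι : Type} [Finite ι] (g : (ι → A) →ₗ[A] M) (hg : Function.Surjective g)
    (hm : ∀ x ∈ LinearMap.ker g, ∀ i, x i ∈ maximalIdeal A) :
    betti A M 1 = residueRank A (LinearMap.ker g) := by
  obtain ⟨e⟩ := nonempty_tor_one_equiv_ker_lTensor_of_left (N := A ⧸ maximalIdeal A)
    (Submodule.subtype_injective _) (LinearMap.exact_subtype_ker_map g) hg
  have h0 : (LinearMap.ker g).subtype.lTensor (A ⧸ maximalIdeal A) = 0 := by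
    cases nonempty_fintype ι
    classical
    refine TensorProduct.ext' fun a x => ?_
    apply (TensorProduct.piScalarRight A A (A ⧸ maximalIdeal A) ι).injective
    ext i
    simp [Algebra.smul_def, Ideal.Quotient.eq_zero_iff_mem.2 (hm x x.2 i)]
  rw [h0, LinearMap.ker_zero] at e
  exact (residueRank_congr (e ≪≫ₗ Submodule.topEquiv)).trans residueRank_tensorProduct

end Betti

section FiberProduct

variable {R S T : Type} [CommRing R] [CommRing S] [CommRing T] [IsLocalRing S] [IsLocalRing T]
  [Algebra R S] [Algebra R T]

variable (R S T) in
/-- The maps `R → S` and `R → T` exhibit `R` as the fiber product of the local rings `S` and `T`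
over their common residue field. -/
structure IsFiberProduct : Prop where
  surjective_left : Function.Surjective (algebraMap R S)
  surjective_right : Function.Surjective (algebraMap R T)
  exists_left : ∀ s ∈ maximalIdeal S, ∃ r : R, algebraMap R S r = s ∧ algebraMap R T r = 0
  exists_right : ∀ t ∈ maximalIdeal T, ∃ r : R, algebraMap R T r = t ∧ algebraMap R S r = 0
  eq_zero : ∀ r : R, algebraMap R S r = 0 → algebraMap R T r = 0 → r = 0
  mem_iff : ∀ r : R, algebraMap R S r ∈ maximalIdeal S ↔ algebraMap R T r ∈ maximalIdeal T

namespace IsFiberProduct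

theorem symm (H : IsFiberProduct R S T) : IsFiberProduct R T S where
  surjective_left := H.surjective_right
  surjective_right := H.surjective_left
  exists_left := H.exists_right
  exists_right := H.exists_left
  eq_zero r h h' := H.eq_zero r h' h
  mem_iff r := (H.mem_iff r).symm

theorem exists_section (H : IsFiberProduct R S T) :
    ∃ σ : maximalIdeal S →ₗ[R] R, ∀ s, algebraMap R S (σ s) = s ∧ algebraMap R T (σ s) = 0 := by
  choose σ hσ using fun s : maximalIdeal S => H.exists_left s s.2
  refine ⟨⟨⟨σ, fun x y => ?_⟩, fun r x => ?_⟩, hσ⟩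
  · rw [← sub_eq_zero]
    apply H.eq_zero <;> simp [hσ]
  · rw [← sub_eq_zero]
    apply H.eq_zero <;> simp [hσ, Algebra.smul_def]

theorem nonempty_residue_equiv (H : IsFiberProduct R S T) :
    Nonempty ((S ⧸ maximalIdeal S) ≃ₗ[R] (T ⧸ maximalIdeal T)) := by
  let f : R →ₗ[R] S ⧸ maximalIdeal S := Algebra.linearMap R _
  let g : R →ₗ[R] T ⧸ maximalIdeal T := Algebra.linearMap R _
  have hf : Function.Surjective f := Ideal.Quotient.mk_surjective.comp H.surjective_left
  have hg : Function.Surjective g := Ideal.Quotient.mk_surjective.comp H.surjective_right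
  have h : LinearMap.ker f = LinearMap.ker g := by
    ext r
    have h₁ : f r = Ideal.Quotient.mk _ (algebraMap R S r) := rfl
    have h₂ : g r = Ideal.Quotient.mk _ (algebraMap R T r) := rfl
    rw [LinearMap.mem_ker, LinearMap.mem_ker, h₁, h₂, Ideal.Quotient.eq_zero_iff_mem,
      Ideal.Quotient.eq_zero_iff_mem, H.mem_iff]
  exact ⟨(f.quotKerEquivOfSurjective hf).symm ≪≫ₗ Submodule.quotEquivOfEq _ _ h ≪≫ₗ
    g.quotKerEquivOfSurjective hg⟩

section TensorProduct

variable {K N : Type} [AddCommGroup K] [Module S K] [Module R K] [IsScalarTower R S K]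
  [AddCommGroup N] [Module T N] [Module R N] [IsScalarTower R T N]

/-- The tensor product over the fiber product of an `S`-module and a `T`-module is a sum of copies
of the residue field. -/
theorem nonempty_tensorProduct_equiv (H : IsFiberProduct R S T) [Module.Finite S K] :
    Nonempty (N ⊗[R] K ≃ₗ[R]
      (Fin (residueRank S K) → N ⧸ (maximalIdeal T • (⊤ : Submodule T N)))) := by
  obtain ⟨e⟩ := nonempty_quotient_smul_top_equiv_pi S K
  obtain ⟨e'⟩ := H.nonempty_residue_equiv
  let W := (maximalIdeal S • (⊤ : Submodule S K)).restrictScalars R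
  have h0 (n : N) (x : K) (hx : x ∈ maximalIdeal S • (⊤ : Submodule S K)) : n ⊗ₜ[R] x = 0 := by
    refine Submodule.smul_induction_on hx (fun s hs x _ => ?_) fun x y hx hy => ?_
    · obtain ⟨r, rfl, hr⟩ := H.exists_left s hs
      rw [algebraMap_smul, TensorProduct.tmul_smul, TensorProduct.smul_tmul',
        ← algebraMap_smul T r n, hr, zero_smul, TensorProduct.zero_tmul]
    · rw [TensorProduct.tmul_add, hx, hy, add_zero]
  have hW : LinearMap.range (TensorProduct.map (LinearMap.id : N →ₗ[R] N) W.subtype) = ⊥ := by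
    rw [LinearMap.range_eq_bot]
    exact TensorProduct.ext' fun n w => h0 n w w.2
  have : TensorProduct.CompatibleSMul R T N (T ⧸ maximalIdeal T) :=
    TensorProduct.CompatibleSMul.of_algebraMap_surjective _ _ H.surjective_right
  let e₁ : N ⊗[R] K ≃ₗ[R] N ⊗[R] (K ⧸ W) :=
    (TensorProduct.tensorQuotientEquiv N W ≪≫ₗ Submodule.quotEquivOfEqBot _ hW).symm
  let e₂ : N ⊗[R] (T ⧸ maximalIdeal T) ≃ₗ[R] N ⧸ (maximalIdeal T • (⊤ : Submodule T N)) :=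
    (TensorProduct.equivOfCompatibleSMul R T R N (T ⧸ maximalIdeal T)).symm ≪≫ₗ
      (TensorProduct.tensorQuotEquivQuotSMul N (maximalIdeal T)).restrictScalars R
  exact ⟨e₁ ≪≫ₗ LinearEquiv.lTensor N (e.restrictScalars R) ≪≫ₗ
    TensorProduct.piRight R R N _ ≪≫ₗ
    LinearEquiv.piCongrRight fun _ => LinearEquiv.lTensor N e' ≪≫ₗ e₂⟩

end TensorProduct

/-- A kernel cut out by the vanishing of the components of an equivalence. -/
def kerEquivPiProd {V W A B C ι : Type*} [AddCommGroup V] [Module R V] [AddCommGroup W]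
    [Module R W] [AddCommGroup A] [Module R A] [AddCommGroup B] [Module R B] [Module T B]
    [IsScalarTower R T B] [AddCommGroup C] [Module T C] (e : V ≃ₗ[R] A × (ι → B))
    (f : V →ₗ[R] W) (h : B →ₗ[T] C) (hf : ∀ x, f x = 0 ↔ ∀ i, h ((e x).2 i) = 0) :
    LinearMap.ker f ≃ₗ[R] (ι → LinearMap.ker h) × A where
  toFun x := (fun i => ⟨(e x).2 i, (hf x).1 x.2 i⟩, (e x).1)
  invFun y := ⟨e.symm (y.2, fun i => y.1 i), (hf _).2 (by simp)⟩
  map_add' x y := by ext <;> simp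
  map_smul' a x := by ext <;> simp
  left_inv x := by ext; simp
  right_inv y := by ext <;> simp

/-- A finitely generated `S`-module has a presentation over the fiber product whose kernel is the
sum of its first syzygy over `S` and copies of the maximal ideal of `T`. -/
theorem exists_presentation (H : IsFiberProduct R S T) [IsNoetherianRing S] (M : Type)
    [AddCommGroup M] [Module S M] [Module R M] [IsScalarTower R S M] [Module.Finite S M] :
    ∃ (L : Type) (_ : AddCommGroup L) (_ : Module R L) (j : L →ₗ[R] (Fin (betti S M 0) → R))
      (g : (Fin (betti S M 0) → R) →ₗ[R] M), Function.Injective j ∧ Function.Exact j g ∧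
        Function.Surjective g ∧
        ∀ (N : Type) [AddCommGroup N] [Module T N] [Module R N] [IsScalarTower R T N],
          Nonempty (LinearMap.ker (j.lTensor N) ≃ₗ[R]
            (Fin (betti S M 0) → LinearMap.ker ((maximalIdeal T).subtype.lTensor N)) ×
            (Fin (betti S M 1) → N ⧸ (maximalIdeal T • (⊤ : Submodule T N)))) := by
  obtain ⟨σ, hσ⟩ := H.exists_section
  obtain ⟨τ, hτ⟩ := H.symm.exists_section
  obtain ⟨g, hg, hm⟩ := exists_minimal_presentation S M
  rw [betti_one g hg hm, betti_zero]
  generalize residueRank S M = b at g hg hm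
  let K := LinearMap.ker g
  let j₁ : K →ₗ[R] (Fin b → R) := LinearMap.pi fun i => σ ∘ₗ
    ((LinearMap.proj i ∘ₗ K.subtype).codRestrict (maximalIdeal S)
      fun x => hm x x.2 i).restrictScalars R
  have hj₁ (x : K) (i : Fin b) : algebraMap R S (j₁ x i) = x.1 i ∧ algebraMap R T (j₁ x i) = 0 :=
    hσ _
  let j₂ : (Fin b → maximalIdeal T) →ₗ[R] (Fin b → R) := τ.compLeft (Fin b)
  have hj₂ (t : Fin b → maximalIdeal T) (i : Fin b) :
      algebraMap R T (j₂ t i) = t i ∧ algebraMap R S (j₂ t i) = 0 := hτ _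
  let j : K × (Fin b → maximalIdeal T) →ₗ[R] (Fin b → R) := j₁.coprod j₂
  have hjS (x : K × (Fin b → maximalIdeal T)) (i : Fin b) :
      algebraMap R S (j x i) = x.1.1 i := by
    simp [j, hj₁, hj₂]
  have hjT (x : K × (Fin b → maximalIdeal T)) (i : Fin b) :
      algebraMap R T (j x i) = x.2 i := by
    simp [j, hj₁, hj₂]
  let p : (Fin b → R) →ₗ[R] (Fin b → S) := (Algebra.linearMap R S).compLeft (Fin b)
  have hp : Function.Surjective p := fun s => by
    choose r hr using fun i => H.surjective_left (s i)
    exact ⟨r, funext hr⟩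
  refine ⟨K × (Fin b → maximalIdeal T), inferInstance, inferInstance, j,
    g.restrictScalars R ∘ₗ p, ?_, ?_, hg.comp hp, ?_⟩
  · intro x y hxy
    refine Prod.ext (Subtype.ext (funext fun i => ?_)) (funext fun i => Subtype.ext ?_)
    · rw [← hjS, ← hjS, hxy]
    · rw [← hjT, ← hjT, hxy]
  · intro r
    constructor
    · intro hr
      have hr' : p r ∈ K := hr
      refine ⟨(⟨p r, hr'⟩, fun i => ⟨algebraMap R T (r i), (H.mem_iff _).1 (hm _ hr' i)⟩), ?_⟩
      funext i
      rw [← sub_eq_zero]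
      apply H.eq_zero
      · rw [map_sub, hjS, sub_eq_zero]
        rfl
      · rw [map_sub, hjT, sub_self]
    · rintro ⟨x, rfl⟩
      have : p (j x) = x.1.1 := funext fun i => hjS x i
      simp only [LinearMap.comp_apply, LinearMap.restrictScalars_apply, this]
      exact x.1.2
  · intro N _ _ _ _
    obtain ⟨eK⟩ := H.nonempty_tensorProduct_equiv (K := K) (N := N)
    have : TensorProduct.CompatibleSMul R T N (maximalIdeal T) :=
      TensorProduct.CompatibleSMul.of_algebraMap_surjective _ _ H.surjective_right
    let eT : N ⊗[R] maximalIdeal T ≃ₗ[R] N ⊗[T] maximalIdeal T :=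
      (TensorProduct.equivOfCompatibleSMul R T R N (maximalIdeal T)).symm
    let e : N ⊗[R] (K × (Fin b → maximalIdeal T)) ≃ₗ[R]
        (N ⊗[R] K) × (Fin b → N ⊗[T] maximalIdeal T) :=
      TensorProduct.prodRight R R N K _ ≪≫ₗ (LinearEquiv.refl R _).prodCongr
        (TensorProduct.piRight R R N _ ≪≫ₗ LinearEquiv.piCongrRight fun _ => eT)
    have he (x) (i : Fin b) : TensorProduct.piScalarRight R R N (Fin b) (j.lTensor N x) i =
        TensorProduct.rid T N ((maximalIdeal T).subtype.lTensor N ((e x).2 i)) := by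
      induction x with
      | zero => simp
      | add x y hx hy => simp only [map_add, Pi.add_apply, Prod.snd_add, hx, hy]
      | tmul n x =>
        have h₁ : (e (n ⊗ₜ x)).2 i = n ⊗ₜ[T] x.2 i := rfl
        rw [h₁, LinearMap.lTensor_tmul, LinearMap.lTensor_tmul, TensorProduct.rid_tmul,
          TensorProduct.piScalarRight_apply, TensorProduct.piScalarRightHom_tmul,
          Submodule.subtype_apply, ← hjT, algebraMap_smul]
    refine ⟨kerEquivPiProd e (j.lTensor N) _ (fun x => ?_) ≪≫ₗ
      (LinearEquiv.refl R _).prodCongr eK⟩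
    rw [← (TensorProduct.piScalarRight R R N (Fin b)).map_eq_zero_iff, funext_iff]
    refine forall_congr' fun i => ?_
    rw [he, Pi.zero_apply, LinearEquiv.map_eq_zero_iff]

variable (M N : Type) [AddCommGroup M] [Module S M] [Module R M] [IsScalarTower R S M]
  [AddCommGroup N] [Module T N] [Module R N] [IsScalarTower R T N]

theorem nonempty_tor_one_equiv_left (H : IsFiberProduct R S T) [IsNoetherianRing S]
    [Module.Finite S M]
    [Module R (((Tor (ModuleCat T) 1).obj (ModuleCat.of T (T ⧸ maximalIdeal T))).obj
      (ModuleCat.of T N))]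
    [IsScalarTower R T (((Tor (ModuleCat T) 1).obj (ModuleCat.of T (T ⧸ maximalIdeal T))).obj
      (ModuleCat.of T N))] :
    Nonempty ((((Tor (ModuleCat R) 1).obj (ModuleCat.of R M)).obj (ModuleCat.of R N)) ≃ₗ[R]
      (Fin (betti S M 0) → (((Tor (ModuleCat T) 1).obj
        (ModuleCat.of T (T ⧸ maximalIdeal T))).obj (ModuleCat.of T N))) ×
      (Fin (betti S M 1) → N ⧸ (maximalIdeal T • (⊤ : Submodule T N)))) := by
  obtain ⟨L, _, _, j, g, hj, hjg, hg, h⟩ := H.exists_presentation M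
  obtain ⟨e⟩ := h N
  obtain ⟨e₁⟩ := nonempty_tor_one_equiv_ker_lTensor_of_left (N := N) hj hjg hg
  obtain ⟨e₂⟩ := nonempty_tor_one_equiv_ker_lTensor_of_left (N := N)
    (Submodule.subtype_injective (maximalIdeal T)) (LinearMap.exact_subtype_mkQ _)
    (Submodule.mkQ_surjective _)
  exact ⟨e₁ ≪≫ₗ e ≪≫ₗ (LinearEquiv.piCongrRight fun _ =>
    (e₂.restrictScalars R).symm).prodCongr (LinearEquiv.refl R _)⟩

theorem nonempty_tor_one_equiv_right (H : IsFiberProduct R S T) [IsNoetherianRing T]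
    [Module.Finite T N]
    [Module R (((Tor (ModuleCat S) 1).obj (ModuleCat.of S M)).obj
      (ModuleCat.of S (S ⧸ maximalIdeal S)))]
    [IsScalarTower R S (((Tor (ModuleCat S) 1).obj (ModuleCat.of S M)).obj
      (ModuleCat.of S (S ⧸ maximalIdeal S)))] :
    Nonempty ((((Tor (ModuleCat R) 1).obj (ModuleCat.of R M)).obj (ModuleCat.of R N)) ≃ₗ[R]
      (Fin (betti T N 0) → (((Tor (ModuleCat S) 1).obj
        (ModuleCat.of S M)).obj (ModuleCat.of S (S ⧸ maximalIdeal S)))) ×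
      (Fin (betti T N 1) → M ⧸ (maximalIdeal S • (⊤ : Submodule S M)))) := by
  obtain ⟨L, _, _, j, g, hj, hjg, hg, h⟩ := H.symm.exists_presentation N
  obtain ⟨e⟩ := h M
  obtain ⟨e₁⟩ := nonempty_tor_one_equiv_ker_lTensor (M := M) hj hjg hg
  obtain ⟨e₂⟩ := nonempty_tor_one_equiv_ker_lTensor (M := M)
    (Submodule.subtype_injective (maximalIdeal S)) (LinearMap.exact_subtype_mkQ _)
    (Submodule.mkQ_surjective _)
  exact ⟨e₁ ≪≫ₗ e ≪≫ₗ (LinearEquiv.piCongrRight fun _ =>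
    (e₂.restrictScalars R).symm).prodCongr (LinearEquiv.refl R _)⟩

end IsFiberProduct

end FiberProduct

end Presentations

theorem isFiberProduct_fiberProd {S T k : Type} [CommRing S] [CommRing T] [Field k]
    [IsLocalRing S] [IsLocalRing T] (πS : S →+* k) (πT : T →+* k)
    (hπS : Function.Surjective πS) (hπT : Function.Surjective πT)
    (hkS : RingHom.ker πS = maximalIdeal S) (hkT : RingHom.ker πT = maximalIdeal T) :
    letI : Algebra ↥(fiberProd πS πT) S := (ρS πS πT).toAlgebra
    letI : Algebra ↥(fiberProd πS πT) T := (ρT πS πT).toAlgebra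
    IsFiberProduct ↥(fiberProd πS πT) S T := by
  let : Algebra ↥(fiberProd πS πT) S := (ρS πS πT).toAlgebra
  let : Algebra ↥(fiberProd πS πT) T := (ρT πS πT).toAlgebra
  have mem {s : S} {t : T} (h : πS s = πT t) : (s, t) ∈ fiberProd πS πT := h
  refine ⟨fun s => ?_, fun t => ?_, fun s hs => ?_, fun t ht => ?_, fun r h₁ h₂ => ?_, fun r => ?_⟩
  · obtain ⟨t, ht⟩ := hπT (πS s)
    exact ⟨⟨(s, t), mem ht.symm⟩, rfl⟩
  · obtain ⟨s, hs⟩ := hπS (πT t)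
    exact ⟨⟨(s, t), mem hs⟩, rfl⟩
  · rw [← hkS, RingHom.mem_ker] at hs
    exact ⟨⟨(s, 0), mem (by rw [hs, map_zero])⟩, rfl, rfl⟩
  · rw [← hkT, RingHom.mem_ker] at ht
    exact ⟨⟨(0, t), mem (by rw [ht, map_zero])⟩, rfl, rfl⟩
  · exact Subtype.ext (Prod.ext h₁ h₂)
  · rw [← hkS, ← hkT, RingHom.mem_ker, RingHom.mem_ker]
    have h : πS (algebraMap _ S r) = πT (algebraMap _ T r) := r.2
    rw [h]

/-- Lemma 2.3 (mixed case): for a finitely generated `S`-module `M₁` and a finitely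
generated `T`-module `N₂`, regarded as modules over the fiber product `R = S ×ₖ T`,
`Tor_1^R(M₁,N₂) ≅ Tor_1^T(k,N₂)^{β_0^S(M₁)} ⊕ (N₂/m_T N₂)^{β_1^S(M₁)}`
`≅ Tor_1^S(M₁,k)^{β_0^T(N₂)} ⊕ (M₁/m_S M₁)^{β_1^T(N₂)}`. -/
theorem stmt_3 (S T k : Type) [CommRing S] [CommRing T] [Field k]
    [IsNoetherianRing S] [IsNoetherianRing T] [IsLocalRing S] [IsLocalRing T]
    (πS : S →+* k) (πT : T →+* k)
    (hπS : Function.Surjective πS) (hπT : Function.Surjective πT)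
    (hkS : RingHom.ker πS = maximalIdeal S) (hkT : RingHom.ker πT = maximalIdeal T)
    (hS : maximalIdeal S ≠ ⊥) (hT : maximalIdeal T ≠ ⊥)
    (M1 N2 : Type) [AddCommGroup M1] [Module S M1] [Module.Finite S M1]
    [AddCommGroup N2] [Module T N2] [Module.Finite T N2] :
    letI : Module ↥(fiberProd πS πT) M1 := Module.compHom M1 (ρS πS πT)
    letI : Module ↥(fiberProd πS πT) N2 := Module.compHom N2 (ρT πS πT)
    letI : Module ↥(fiberProd πS πT)
        (((Tor (ModuleCat T) 1).obj (ModuleCat.of T (T ⧸ maximalIdeal T))).obj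
          (ModuleCat.of T N2)) :=
      Module.compHom _ (ρT πS πT)
    letI : Module ↥(fiberProd πS πT)
        (((Tor (ModuleCat S) 1).obj (ModuleCat.of S M1)).obj
          (ModuleCat.of S (S ⧸ maximalIdeal S))) :=
      Module.compHom _ (ρS πS πT)
    letI : Module ↥(fiberProd πS πT) (N2 ⧸ (maximalIdeal T • (⊤ : Submodule T N2))) :=
      Module.compHom _ (ρT πS πT)
    letI : Module ↥(fiberProd πS πT) (M1 ⧸ (maximalIdeal S • (⊤ : Submodule S M1))) :=
      Module.compHom _ (ρS πS πT)
    (Nonempty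
      ((((Tor (ModuleCat ↥(fiberProd πS πT)) 1).obj
          (ModuleCat.of ↥(fiberProd πS πT) M1)).obj (ModuleCat.of ↥(fiberProd πS πT) N2))
        ≃ₗ[↥(fiberProd πS πT)]
        ((Fin (betti S M1 0) →
            (((Tor (ModuleCat T) 1).obj (ModuleCat.of T (T ⧸ maximalIdeal T))).obj
              (ModuleCat.of T N2))) ×
          (Fin (betti S M1 1) →
            N2 ⧸ (maximalIdeal T • (⊤ : Submodule T N2)))))) ∧
    (Nonempty
      ((((Tor (ModuleCat ↥(fiberProd πS πT)) 1).obj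
          (ModuleCat.of ↥(fiberProd πS πT) M1)).obj (ModuleCat.of ↥(fiberProd πS πT) N2))
        ≃ₗ[↥(fiberProd πS πT)]
        ((Fin (betti T N2 0) →
            (((Tor (ModuleCat S) 1).obj (ModuleCat.of S M1)).obj
              (ModuleCat.of S (S ⧸ maximalIdeal S)))) ×
          (Fin (betti T N2 1) →
            M1 ⧸ (maximalIdeal S • (⊤ : Submodule S M1)))))) := by
  let : Algebra ↥(fiberProd πS πT) S := (ρS πS πT).toAlgebra
  let : Algebra ↥(fiberProd πS πT) T := (ρT πS πT).toAlgebra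
  let : Module ↥(fiberProd πS πT) M1 := Module.compHom M1 (ρS πS πT)
  let : Module ↥(fiberProd πS πT) N2 := Module.compHom N2 (ρT πS πT)
  let : Module ↥(fiberProd πS πT) (((Tor (ModuleCat T) 1).obj
      (ModuleCat.of T (T ⧸ maximalIdeal T))).obj (ModuleCat.of T N2)) :=
    Module.compHom _ (ρT πS πT)
  let : Module ↥(fiberProd πS πT) (((Tor (ModuleCat S) 1).obj
      (ModuleCat.of S M1)).obj (ModuleCat.of S (S ⧸ maximalIdeal S))) :=
    Module.compHom _ (ρS πS πT)
  have H := isFiberProduct_fiberProd πS πT hπS hπT hkS hkT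
  have : IsScalarTower ↥(fiberProd πS πT) S M1 := ⟨fun r _ x => mul_smul (algebraMap _ _ r) _ x⟩
  have : IsScalarTower ↥(fiberProd πS πT) T N2 := ⟨fun r _ x => mul_smul (algebraMap _ _ r) _ x⟩
  have : IsScalarTower ↥(fiberProd πS πT) T (((Tor (ModuleCat T) 1).obj
      (ModuleCat.of T (T ⧸ maximalIdeal T))).obj (ModuleCat.of T N2)) := ⟨fun r _ x => mul_smul (algebraMap _ _ r) _ x⟩
  have : IsScalarTower ↥(fiberProd πS πT) S (((Tor (ModuleCat S) 1).obj
      (ModuleCat.of S M1)).obj (ModuleCat.of S (S ⧸ maximalIdeal S))) := ⟨fun r _ x => mul_smul (algebraMap _ _ r) _ x⟩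
  exact ⟨H.nonempty_tor_one_equiv_left M1 N2, H.nonempty_tor_one_equiv_right M1 N2⟩
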